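/- arXiv:2408.14150 — 8 statements merged into one kernel-verified Lean document; each statement's English description precedes it below -/
import Mathlib

section
/- Suppose x̄ is an optimal solution of problem P1: maximize pᵀx subject to Ax = b, x ≥ 0. If x* ∈ ℝ^n satisfies x* ≥ 0 and {j : x*_j > 0} ⊆ {j : x̄_j > 0}, then x* is an optimal solution of the problem P2: maximize pᵀx subject to Ax = A x*, x ≥ 0. -/
open Matrix

/-- A point `x` is an optimal solution of the problem
maximize `pᵀx` subject to `Ax = b`, `x ≥ 0`. -/
def IsOptimalSol {m n : ℕ} (A : Matrix (Fin m) (Fin n) ℝ) (b : Fin m → ℝ)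
    (p : Fin n → ℝ) (x : Fin n → ℝ) : Prop :=
  A *ᵥ x = b ∧ (∀ j, 0 ≤ x j) ∧
    ∀ x' : Fin n → ℝ, A *ᵥ x' = b → (∀ j, 0 ≤ x' j) → p ⬝ᵥ x' ≤ p ⬝ᵥ x

open Filter Topology in
/-- If the support of `x` is contained in that of `y`, a small positive multiple of `x`
is dominated by `y`. -/
theorem exists_pos_mul_le_of_support {ι : Type*} [Finite ι] {x y : ι → ℝ}
    (hx : ∀ j, 0 ≤ x j) (hy : ∀ j, 0 ≤ y j) (hxy : ∀ j, 0 < x j → 0 < y j) :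
    ∃ t : ℝ, 0 < t ∧ ∀ j, t * x j ≤ y j := by
  have h : ∀ᶠ t : ℝ in 𝓝[>] 0, ∀ j, t * x j ≤ y j := by
    rw [eventually_all]
    intro j
    rcases (hx j).eq_or_lt with h0 | hpos
    · simp [← h0, hy j]
    · have ht : Tendsto (fun t : ℝ => t * x j) (𝓝 0) (𝓝 0) := by
        simpa using (continuous_mul_const (x j)).tendsto 0
      exact ((ht.eventually_lt_const (hxy j hpos)).filter_mono nhdsWithin_le_nhds).mono
        fun _ h => h.le
  obtain ⟨t, h, ht⟩ := (h.and self_mem_nhdsWithin).exists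
  exact ⟨t, ht, h⟩

theorem stmt_1 {m n : ℕ} (A : Matrix (Fin m) (Fin n) ℝ) (b : Fin m → ℝ)
    (p : Fin n → ℝ) (xbar xs : Fin n → ℝ)
    (hxbar : IsOptimalSol A b p xbar)
    (hxs_nonneg : ∀ j, 0 ≤ xs j)
    (hsupp : ∀ j, 0 < xs j → 0 < xbar j) :
    IsOptimalSol A (A *ᵥ xs) p xs := by
  obtain ⟨hA, hnn, hopt⟩ := hxbar
  refine ⟨rfl, hxs_nonneg, fun x' hAx' hx' => ?_⟩
  obtain ⟨t, ht, hle⟩ := exists_pos_mul_le_of_support hxs_nonneg hnn hsupp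
  have key := hopt (xbar + t • (x' - xs))
    (by rw [mulVec_add, mulVec_smul, mulVec_sub, hAx', sub_self, smul_zero, add_zero, hA])
    (fun j => by
      have := mul_nonneg ht.le (hx' j)
      have := hle j
      simp only [Pi.add_apply, Pi.smul_apply, Pi.sub_apply, smul_eq_mul]
      linarith)
  rw [dotProduct_add, dotProduct_smul, dotProduct_sub, smul_eq_mul] at key
  exact sub_nonpos.mp (nonpos_of_mul_nonpos_right (by linarith) ht)
end

section
/- Let x̄ be an optimal solution of problem P1 and let I⁰(x̄) = {j : x̄_j = 0}. Then the following are equivalent: (a) the zero vector is the unique optimal solution of the problem: maximize pᵀh subject to Ah = 0 and h_j ≥ 0 for all j ∈ I⁰(x̄) (i.e., every h with Ah = 0, h_j ≥ 0 for all j ∈ I⁰(x̄) and pᵀh ≥ 0 equals 0); (b) for every nonzero q ∈ ℝ^n there exists ε > 0 such that for all δ ∈ (0, ε), the zero vector is an optimal solution of the problem: maximize (p + δq)ᵀh subject to Ah = 0 and h_j ≥ 0 for all j ∈ I⁰(x̄) (i.e., (p + δq)ᵀh ≤ 0 for every h with Ah = 0 and h_j ≥ 0 for all j ∈ I⁰(x̄)).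 -/
open Matrix

/-- A continuous function that is negative on a compact set stays nonpositive there under every
sufficiently small multiple of a continuous perturbation. -/
theorem IsCompact.exists_pos_forall_add_mul_nonpos {X : Type*} [TopologicalSpace X] {S : Set X}
    (hS : IsCompact S) {f g : X → ℝ} (hf : ContinuousOn f S) (hg : ContinuousOn g S)
    (hneg : ∀ x ∈ S, f x < 0) :
    ∃ ε > (0 : ℝ), ∀ δ : ℝ, 0 < δ → δ < ε → ∀ x ∈ S, f x + δ * g x ≤ 0 := by
  rcases S.eq_empty_or_nonempty with rfl | hne
  · exact ⟨1, one_pos, by simp⟩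
  obtain ⟨a, ha, hfa⟩ := hS.exists_isMaxOn hne hf
  obtain ⟨c, -, hgc⟩ := hS.exists_isMaxOn hne hg
  have hM : 0 < |g c| + 1 := by positivity
  refine ⟨-f a / (|g c| + 1), div_pos (neg_pos.2 (hneg a ha)) hM, fun δ hδ hδε x hx => ?_⟩
  rw [lt_div_iff₀ hM] at hδε
  have hfx : f x ≤ f a := hfa hx
  have hgx : g x ≤ |g c| + 1 := by linarith [show g x ≤ g c from hgc hx, le_abs_self (g c)]
  linarith [mul_le_mul_of_nonneg_left hgx hδ.le]

theorem stmt_2 {m n : ℕ} (A : Matrix (Fin m) (Fin n) ℝ) (b : Fin m → ℝ)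
    (p : Fin n → ℝ) (xbar : Fin n → ℝ)
    (hxbar : IsOptimalSol A b p xbar) :
    (∀ h : Fin n → ℝ, A *ᵥ h = 0 → (∀ j, xbar j = 0 → 0 ≤ h j) →
        0 ≤ p ⬝ᵥ h → h = 0)
      ↔
    (∀ q : Fin n → ℝ, q ≠ 0 → ∃ ε > (0 : ℝ), ∀ δ : ℝ, 0 < δ → δ < ε →
        ∀ h : Fin n → ℝ, A *ᵥ h = 0 → (∀ j, xbar j = 0 → 0 ≤ h j) →
          (p + δ • q) ⬝ᵥ h ≤ 0) := by
  constructor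
  · intro huniq q _
    have hclosed : IsClosed {h : Fin n → ℝ | A *ᵥ h = 0 ∧ ∀ j, xbar j = 0 → 0 ≤ h j} := by
      simp only [Set.ofPred_and, Set.ofPred_forall]
      refine (isClosed_eq (by fun_prop) continuous_const).inter
        (isClosed_iInter fun j => isClosed_iInter fun _ => ?_)
      exact isClosed_le continuous_const (continuous_apply j)
    obtain ⟨ε, hε, hε_le⟩ :=
      ((isCompact_sphere (0 : Fin n → ℝ) 1).inter_right hclosed).exists_pos_forall_add_mul_nonpos
        (f := fun h => p ⬝ᵥ h) (g := fun h => q ⬝ᵥ h) (by fun_prop) (by fun_prop) (by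
          rintro h ⟨hnorm, hA, hpos⟩
          by_contra! hp
          simp [huniq h hA hpos hp] at hnorm)
    refine ⟨ε, hε, fun δ hδ hδε h hA hpos => ?_⟩
    rcases eq_or_ne h 0 with rfl | hne
    · simp
    have hnorm : 0 < ‖h‖ := norm_pos_iff.2 hne
    have hle := hε_le δ hδ hδε (‖h‖⁻¹ • h)
      ⟨by simp [norm_smul, hnorm.ne'], by simp [mulVec_smul, hA],
        fun j hj => mul_nonneg (inv_nonneg.2 hnorm.le) (hpos j hj)⟩
    simp only [dotProduct_smul, smul_eq_mul] at hle
    rw [add_dotProduct, smul_dotProduct, smul_eq_mul]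
    refine nonpos_of_mul_nonpos_right (a := ‖h‖⁻¹) ?_ (inv_pos.2 hnorm)
    linarith
  · intro hstable h hA hpos hp
    by_contra hne
    obtain ⟨ε, hε, hε_le⟩ := hstable h hne
    have hle := hε_le (ε / 2) (half_pos hε) (half_lt_self hε) h hA hpos
    rw [add_dotProduct, smul_dotProduct, smul_eq_mul] at hle
    have hself : 0 < h ⬝ᵥ h :=
      lt_of_le_of_ne (Finset.sum_nonneg fun i _ => mul_self_nonneg (h i))
        fun h0 => hne (dotProduct_self_eq_zero.1 h0.symm)
    linarith [mul_pos (half_pos hε) hself]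
end

section
/- (Mangasarian's uniqueness theorem.) Let x̄ be an optimal solution of problem P1: maximize pᵀx subject to Ax = b, x ≥ 0. Then x̄ is the unique optimal solution of P1 if and only if for every nonzero q ∈ ℝ^n there exists ε > 0 such that for all δ ∈ (0, ε), x̄ is an optimal solution of the perturbed problem: maximize (p + δq)ᵀx subject to Ax = b, x ≥ 0. -/
open Matrix

/-- If `p` is negative on the nonzero vectors of a closed cone, then every sufficiently small
perturbation of `p` is nonpositive on that cone. -/
theorem exists_forall_add_smul_dotProduct_nonpos {ι : Type*} [Fintype ι] {T : Set (ι → ℝ)}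
    (hT : IsClosed T) (hcone : ∀ t : ℝ, 0 < t → ∀ d ∈ T, t • d ∈ T) {p : ι → ℝ}
    (hp : ∀ d ∈ T, d ≠ 0 → p ⬝ᵥ d < 0) (q : ι → ℝ) :
    ∃ ε > (0 : ℝ), ∀ δ : ℝ, 0 < δ → δ < ε → ∀ d ∈ T, (p + δ • q) ⬝ᵥ d ≤ 0 := by
  have hcont (r : ι → ℝ) : Continuous fun d : ι → ℝ => r ⬝ᵥ d := by
    unfold dotProduct
    fun_prop
  have hS : IsCompact (T ∩ Metric.sphere 0 1) := (isCompact_sphere 0 1).inter_left hT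
  obtain ⟨c, hc, hpc⟩ := hS.exists_forall_le' (a := 0) (hcont p).neg.continuousOn fun d hd =>
    neg_pos.2 (hp d hd.1 (ne_zero_of_mem_unit_sphere ⟨d, hd.2⟩))
  obtain ⟨K, hK⟩ := hS.bddAbove_image (hcont q).continuousOn
  have hK1 : 0 < |K| + 1 := by positivity
  refine ⟨c / (|K| + 1), by positivity, fun δ hδ hδε d hd => ?_⟩
  rcases eq_or_ne d 0 with rfl | hd0
  · simp
  have hnorm : 0 < ‖d‖ := norm_pos_iff.2 hd0
  have hu : ‖d‖⁻¹ • d ∈ T ∩ Metric.sphere 0 1 :=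
    ⟨hcone _ (by positivity) d hd, by simp [norm_smul, hnorm.ne']⟩
  have h1 : c ≤ -(p ⬝ᵥ (‖d‖⁻¹ • d)) := hpc _ hu
  have h2 : q ⬝ᵥ (‖d‖⁻¹ • d) ≤ K := hK ⟨_, hu, rfl⟩
  have h3 : (p + δ • q) ⬝ᵥ (‖d‖⁻¹ • d) ≤ 0 := by
    rw [lt_div_iff₀ hK1] at hδε
    rw [add_dotProduct, smul_dotProduct, smul_eq_mul]
    nlinarith [le_abs_self K]
  rw [dotProduct_smul, smul_eq_mul] at h3
  exact nonpos_of_mul_nonpos_right h3 (by positivity)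

/-- A direction that is nonnegative wherever the nonnegative vector `x` vanishes can be followed
for a positive time without leaving the nonnegative orthant. -/
theorem exists_pos_forall_add_smul_nonneg {ι : Type*} [Finite ι] {x d : ι → ℝ}
    (hx : ∀ j, 0 ≤ x j) (hd : ∀ j, x j = 0 → 0 ≤ d j) :
    ∃ t > (0 : ℝ), ∀ j, 0 ≤ (x + t • d) j := by
  have h : ∀ᶠ t in nhdsWithin (0 : ℝ) (Set.Ioi 0), ∀ j, 0 ≤ (x + t • d) j := by
    refine Filter.eventually_all.2 fun j => ?_
    rcases (hx j).eq_or_lt with hj | hj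
    · filter_upwards [self_mem_nhdsWithin] with t ht
      simpa [← hj] using mul_nonneg (le_of_lt ht) (hd j hj.symm)
    · have hc : Continuous fun t : ℝ => (x + t • d) j := by
        simp only [Pi.add_apply, Pi.smul_apply]
        fun_prop
      have := (hc.tendsto 0).eventually_const_lt (u := 0) (by simpa using hj)
      exact (this.filter_mono nhdsWithin_le_nhds).mono fun t ht => ht.le
  obtain ⟨t, ht, ht0⟩ := (h.and self_mem_nhdsWithin).exists
  exact ⟨t, ht0, ht⟩

/-- The cone of feasible directions at `x` of the polyhedron `Ax = b`, `x ≥ 0`. -/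
def feasibleDirections {m n : ℕ} (A : Matrix (Fin m) (Fin n) ℝ) (x : Fin n → ℝ) :
    Set (Fin n → ℝ) :=
  {d | A *ᵥ d = 0 ∧ ∀ j, x j = 0 → 0 ≤ d j}

theorem isClosed_feasibleDirections {m n : ℕ} (A : Matrix (Fin m) (Fin n) ℝ) (x : Fin n → ℝ) :
    IsClosed (feasibleDirections A x) := by
  have hnonneg : IsClosed {d : Fin n → ℝ | ∀ j, x j = 0 → 0 ≤ d j} := by
    simp only [Set.ofPred_forall]
    exact isClosed_iInter fun j => isClosed_iInter fun _ =>
      isClosed_le continuous_const (continuous_apply j)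
  exact (isClosed_eq (by fun_prop) continuous_const).inter hnonneg

theorem dotProduct_neg_of_mem_feasibleDirections {m n : ℕ} {A : Matrix (Fin m) (Fin n) ℝ}
    {b : Fin m → ℝ} {p x : Fin n → ℝ} (hx : IsOptimalSol A b p x)
    (huniq : ∀ y, IsOptimalSol A b p y → y = x) {d : Fin n → ℝ}
    (hd : d ∈ feasibleDirections A x) (hd0 : d ≠ 0) : p ⬝ᵥ d < 0 := by
  obtain ⟨t, ht, hnonneg⟩ := exists_pos_forall_add_smul_nonneg hx.2.1 hd.2
  by_contra! hpd
  have hopt : IsOptimalSol A b p (x + t • d) := by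
    refine ⟨by simp [mulVec_add, mulVec_smul, hx.1, hd.1], hnonneg, fun y hy hy0 =>
      (hx.2.2 y hy hy0).trans ?_⟩
    rw [dotProduct_add, dotProduct_smul, smul_eq_mul]
    exact le_add_of_nonneg_right (mul_nonneg ht.le hpd)
  exact smul_ne_zero ht.ne' hd0 (add_eq_left.1 (huniq _ hopt))

theorem stmt_4 {m n : ℕ} (A : Matrix (Fin m) (Fin n) ℝ) (b : Fin m → ℝ)
    (p : Fin n → ℝ) (xbar : Fin n → ℝ)
    (hxbar : IsOptimalSol A b p xbar) :
    (∀ y : Fin n → ℝ, IsOptimalSol A b p y → y = xbar)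
      ↔
    (∀ q : Fin n → ℝ, q ≠ 0 → ∃ ε > (0 : ℝ), ∀ δ : ℝ, 0 < δ → δ < ε →
        IsOptimalSol A b (p + δ • q) xbar) := by
  constructor
  · intro huniq q _
    obtain ⟨ε, hε, h⟩ := exists_forall_add_smul_dotProduct_nonpos
      (isClosed_feasibleDirections A xbar)
      (fun t ht d hd => ⟨by rw [mulVec_smul, hd.1, smul_zero],
        fun j hj => mul_nonneg ht.le (hd.2 j hj)⟩)
      (fun d hd => dotProduct_neg_of_mem_feasibleDirections hxbar huniq hd) q
    refine ⟨ε, hε, fun δ hδ hδε => ⟨hxbar.1, hxbar.2.1, fun y hy hy0 => ?_⟩⟩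
    have := h δ hδ hδε (y - xbar)
      ⟨by rw [mulVec_sub, hy, hxbar.1, sub_self], fun j hj => by simpa [hj] using hy0 j⟩
    rwa [dotProduct_sub, sub_nonpos] at this
  · intro h y hy
    by_contra hne
    obtain ⟨ε, hε, hopt⟩ := h (y - xbar) (sub_ne_zero.2 hne)
    have hle := (hopt (ε / 2) (by positivity) (by linarith)).2.2 y hy.1 hy.2.1
    have hge := hy.2.2 xbar hxbar.1 hxbar.2.1
    have hpos : 0 < (y - xbar) ⬝ᵥ (y - xbar) :=
      (Finset.sum_nonneg fun j _ => mul_self_nonneg ((y - xbar) j)).lt_of_ne'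
        (mt dotProduct_self_eq_zero.1 (sub_ne_zero.2 hne))
    rw [dotProduct_sub] at hpos
    simp only [add_dotProduct, smul_dotProduct, smul_eq_mul] at hle
    nlinarith
end

section
/- Suppose X = {x ∈ ℝ^n : Ax = b, x ≥ 0} is nonempty and bounded, let Y be the set of optimal solutions of problem P1 (maximize pᵀx over X), and let Y* = Y ∩ X* be the set of basic optimal solutions. Then Y equals the set of all convex combinations of the (finitely many) points of Y*, i.e., Y = { Σ_{y* ∈ Y*} α_{y*} y* : α_{y*} ≥ 0 for all y* ∈ Y* and Σ_{y* ∈ Y*} α_{y*} = 1 }. -/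
open Matrix

/-- Moving from a nonnegative vector along a direction with a negative entry, supported on the
support of the vector, one reaches a nonnegative vector of strictly smaller support. -/
lemma exists_pos_step_nonneg {ι : Type*} [Fintype ι] {x d : ι → ℝ} (hx : ∀ j, 0 ≤ x j)
    (hd : ∀ j, d j ≠ 0 → 0 < x j) (hneg : ∃ j, d j < 0) :
    ∃ t : ℝ, 0 < t ∧ (∀ j, 0 ≤ (x + t • d) j) ∧
      {j | 0 < (x + t • d) j} ⊂ {j | 0 < x j} := by
  classical
  obtain ⟨j₀, hj₀⟩ := hneg
  obtain ⟨i, hi, hmin⟩ := Finset.exists_min_image (Finset.univ.filter fun j => d j < 0)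
    (fun j => x j / -d j) ⟨j₀, by simpa using hj₀⟩
  replace hi : d i < 0 := by simpa using hi
  have hxi : 0 < x i := hd i hi.ne
  refine ⟨x i / -d i, div_pos hxi (neg_pos.2 hi), fun j => ?_, ?_⟩
  · simp only [Pi.add_apply, Pi.smul_apply, smul_eq_mul]
    rcases lt_or_ge (d j) 0 with hj | hj
    · have h := hmin j (by simpa using hj)
      rw [le_div_iff₀ (neg_pos.2 hj)] at h
      linarith
    · exact add_nonneg (hx j) (mul_nonneg (div_pos hxi (neg_pos.2 hi)).le hj)
  · refine (Set.ssubset_iff_of_subset fun j hj => ?_).2 ⟨i, hxi, ?_⟩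
    · by_contra h
      have hdj : d j = 0 := by
        by_contra h'
        exact h (hd j h')
      simp only [Set.mem_ofPred_eq, Pi.add_apply, Pi.smul_apply, smul_eq_mul, hdj, mul_zero,
        add_zero] at hj
      exact h hj
    · have hz : x i / -d i * d i = -x i := by
        rw [div_neg, neg_mul, div_mul_cancel₀ _ hi.ne]
      simp [hz]

/-- Linearly dependent columns over the support of `x` give a nonzero kernel vector supported
there. -/
lemma exists_mulVec_eq_zero_of_not_linearIndependent {m n : Type*} [Fintype n]
    {A : Matrix m n ℝ} {x : n → ℝ}
    (h : ¬ LinearIndependent ℝ (fun j : {j : n // 0 < x j} => Aᵀ j.1)) :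
    ∃ d : n → ℝ, A *ᵥ d = 0 ∧ d ≠ 0 ∧ ∀ j, d j ≠ 0 → 0 < x j := by
  classical
  obtain ⟨g, hg, i, hi⟩ := Fintype.not_linearIndependent_iff.1 h
  refine ⟨fun j => if hj : 0 < x j then g ⟨j, hj⟩ else 0, ?_, fun h0 => hi ?_, fun j hj => ?_⟩
  · rw [Matrix.mulVec_eq_sum, ← Fintype.sum_subtype_add_sum_subtype (fun j => 0 < x j)]
    have h1 : ∀ j : {j : n // 0 < x j}, (if hj : 0 < x j then g ⟨j, hj⟩ else 0) = g j :=
      fun j => dif_pos j.2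
    have h2 : ∀ j : {j : n // ¬ 0 < x j}, (if hj : 0 < x j then g ⟨j, hj⟩ else 0) = 0 :=
      fun j => dif_neg j.2
    simpa [h1, h2] using hg
  · simpa [i.2] using congrFun h0 i.1
  · by_contra hx
    simp [hx] at hj

/-- A nonzero kernel vector has a negative entry when the polyhedron is bounded. -/
lemma exists_neg_of_isBounded {m n : Type*} [Fintype n] {A : Matrix m n ℝ} {b : m → ℝ}
    (hbd : Bornology.IsBounded {x | A *ᵥ x = b ∧ ∀ j, 0 ≤ x j}) {x d : n → ℝ}
    (hx : A *ᵥ x = b ∧ ∀ j, 0 ≤ x j) (hAd : A *ᵥ d = 0) (hd : d ≠ 0) : ∃ j, d j < 0 := by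
  by_contra! hnn
  obtain ⟨i, hi⟩ := Function.ne_iff.1 hd
  have hi' : 0 < d i := lt_of_le_of_ne (hnn i) (Ne.symm hi)
  obtain ⟨C, hC⟩ := hbd.exists_norm_le
  have hC0 : 0 ≤ C := (norm_nonneg x).trans (hC x hx)
  have ht : 0 ≤ (C + 1) / d i := by positivity
  have hmem := hC (x + ((C + 1) / d i) • d)
    ⟨by rw [Matrix.mulVec_add, Matrix.mulVec_smul, hAd, smul_zero, add_zero, hx.1],
      fun j => add_nonneg (hx.2 j) (mul_nonneg ht (hnn j))⟩
  have h := (le_abs_self _).trans ((norm_le_pi_norm _ i).trans hmem)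
  simp only [Pi.add_apply, Pi.smul_apply, smul_eq_mul, div_mul_cancel₀ _ hi'.ne'] at h
  linarith [hx.2 i]

/-- Every optimal solution of a linear program over a bounded polyhedron lies in the convex hull
of the basic optimal solutions. -/
lemma mem_convexHull_basic_optimal {m n : Type*} [Fintype n] {A : Matrix m n ℝ} {b : m → ℝ}
    {p : n → ℝ} {X Y : Set (n → ℝ)} (hX : X = {x | A *ᵥ x = b ∧ ∀ j, 0 ≤ x j})
    (hbd : Bornology.IsBounded X) (hY : Y = {y ∈ X | ∀ x ∈ X, p ⬝ᵥ x ≤ p ⬝ᵥ y})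
    {y : n → ℝ} (hy : y ∈ Y) :
    y ∈ convexHull ℝ (Y ∩ {x ∈ X |
      LinearIndependent ℝ (fun j : {j : n // 0 < x j} => Aᵀ j.1)}) := by
  induction hk : {j | 0 < y j}.ncard using Nat.strong_induction_on generalizing y with
  | _ k ih =>
  subst hk
  have hyY := hy
  rw [hY] at hy
  obtain ⟨hyX, hopt⟩ := hy
  by_cases hli : LinearIndependent ℝ (fun j : {j : n // 0 < y j} => Aᵀ j.1)
  · exact subset_convexHull ℝ _ ⟨hyY, hyX, hli⟩
  obtain ⟨d, hAd, hd, hsupp⟩ := exists_mulVec_eq_zero_of_not_linearIndependent hli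
  have hy' : A *ᵥ y = b ∧ ∀ j, 0 ≤ y j := by simpa [hX] using hyX
  have hAd' : A *ᵥ (-d) = 0 := by rw [Matrix.mulVec_neg, hAd, neg_zero]
  obtain ⟨s, hs, hs0, hslt⟩ := exists_pos_step_nonneg hy'.2 hsupp
    (exists_neg_of_isBounded (hX ▸ hbd) hy' hAd hd)
  obtain ⟨t, ht, ht0, htlt⟩ := exists_pos_step_nonneg (d := -d) hy'.2
    (fun j hj => hsupp j (by simpa using hj))
    (exists_neg_of_isBounded (hX ▸ hbd) hy' hAd' (neg_ne_zero.2 hd))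
  have hsX : y + s • d ∈ X := by
    rw [hX]
    exact ⟨by rw [Matrix.mulVec_add, Matrix.mulVec_smul, hAd, smul_zero, add_zero, hy'.1], hs0⟩
  have htX : y + t • -d ∈ X := by
    rw [hX]
    exact ⟨by rw [Matrix.mulVec_add, Matrix.mulVec_smul, hAd', smul_zero, add_zero, hy'.1], ht0⟩
  have hpd : p ⬝ᵥ d = 0 := by
    have h1 := hopt _ hsX
    have h2 := hopt _ htX
    simp only [dotProduct_add, dotProduct_smul, dotProduct_neg, smul_eq_mul] at h1 h2
    nlinarith
  have hsY : y + s • d ∈ Y := by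
    rw [hY]
    exact ⟨hsX, fun x hx => by simpa [dotProduct_add, dotProduct_smul, hpd] using hopt x hx⟩
  have htY : y + t • -d ∈ Y := by
    rw [hY]
    exact ⟨htX, fun x hx => by simpa [dotProduct_add, dotProduct_smul, hpd] using hopt x hx⟩
  have hsH := ih _ (Set.ncard_lt_ncard hslt (Set.toFinite _)) hsY rfl
  have htH := ih _ (Set.ncard_lt_ncard htlt (Set.toFinite _)) htY rfl
  have hst : 0 < s + t := add_pos hs ht
  have hcomb := convex_convexHull ℝ _ hsH htH (div_pos ht hst).le (div_pos hs hst).le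
    (by field_simp; ring)
  convert hcomb using 1
  ext j
  simp only [Pi.add_apply, Pi.smul_apply, Pi.neg_apply, smul_eq_mul]
  field_simp
  ring

/-- The set of optimal solutions of a linear program is convex. -/
lemma convex_optimal {m n : Type*} [Fintype n] {A : Matrix m n ℝ} {b : m → ℝ} {p : n → ℝ}
    {X Y : Set (n → ℝ)} (hX : X = {x | A *ᵥ x = b ∧ ∀ j, 0 ≤ x j})
    (hY : Y = {y ∈ X | ∀ x ∈ X, p ⬝ᵥ x ≤ p ⬝ᵥ y}) : Convex ℝ Y := by
  subst hY hX
  rintro u ⟨⟨hu, hu0⟩, huopt⟩ v ⟨⟨hv, hv0⟩, hvopt⟩ α β hα hβ hαβ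
  refine ⟨⟨?_, fun j => add_nonneg (mul_nonneg hα (hu0 j)) (mul_nonneg hβ (hv0 j))⟩,
    fun x hx => ?_⟩
  · rw [Matrix.mulVec_add, Matrix.mulVec_smul, Matrix.mulVec_smul, hu, hv, ← add_smul, hαβ,
      one_smul]
  · simp only [dotProduct_add, dotProduct_smul, smul_eq_mul]
    calc p ⬝ᵥ x = α * (p ⬝ᵥ x) + β * (p ⬝ᵥ x) := by rw [← add_mul, hαβ, one_mul]
      _ ≤ _ := add_le_add (mul_le_mul_of_nonneg_left (huopt x hx) hα)
        (mul_le_mul_of_nonneg_left (hvopt x hx) hβ)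

theorem stmt_8 {m n : ℕ} (A : Matrix (Fin m) (Fin n) ℝ) (b : Fin m → ℝ)
    (p : Fin n → ℝ)
    (X Xstar Y Ystar : Set (Fin n → ℝ))
    (hX : X = {x | A *ᵥ x = b ∧ ∀ j, 0 ≤ x j})
    (hXne : X.Nonempty) (hXbd : Bornology.IsBounded X)
    (hXstar : Xstar =
      {x ∈ X | LinearIndependent ℝ (fun j : {j : Fin n // 0 < x j} => Aᵀ j.1)})
    (hY : Y = {y ∈ X | ∀ x ∈ X, p ⬝ᵥ x ≤ p ⬝ᵥ y})
    (hYstar : Ystar = Y ∩ Xstar) :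
    Y = {y | ∃ (s : Finset (Fin n → ℝ)) (w : (Fin n → ℝ) → ℝ),
          ↑s ⊆ Ystar ∧ (∀ z ∈ s, 0 ≤ w z) ∧ ∑ z ∈ s, w z = 1 ∧
          ∑ z ∈ s, w z • z = y} := by
  ext y
  constructor
  · intro hy
    have h := mem_convexHull_basic_optimal hX hXbd hY hy
    rw [← hXstar, ← hYstar, convexHull_eq_union_convexHull_finite_subsets] at h
    simp only [Set.mem_iUnion, Finset.mem_convexHull'] at h
    obtain ⟨s, hs, w, hw⟩ := h
    exact ⟨s, w, hs, hw⟩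
  · rintro ⟨s, w, hs, hw0, hw1, rfl⟩
    exact (convex_optimal hX hY).sum_mem hw0 hw1 fun z hz => (hYstar ▸ hs hz :).1
end

section
/- Suppose X = {x ∈ ℝ^n : Ax = b, x ≥ 0} is nonempty and bounded, let Y be the set of optimal solutions of problem P1 (maximize pᵀx over X), and let Y* = Y ∩ X* be the set of basic optimal solutions. Then Y* is exactly the set of extreme points of Y. -/
open Matrix

/-- The columns of `A` indexed by `s` are linearly independent iff the only vector of `ker A`
supported on `s` is zero. -/
lemma linearIndependent_cols_subtype_iff {m n : ℕ} (A : Matrix (Fin m) (Fin n) ℝ)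
    (s : Fin n → Prop) :
    LinearIndependent ℝ (fun j : {j : Fin n // s j} => Aᵀ j.1) ↔
      ∀ d : Fin n → ℝ, A *ᵥ d = 0 → (∀ j, ¬ s j → d j = 0) → d = 0 := by
  classical
  have key : ∀ d : Fin n → ℝ, (∀ j, ¬ s j → d j = 0) →
      A *ᵥ d = ∑ j : {j : Fin n // s j}, d j.1 • Aᵀ j.1 := by
    intro d hd
    have hcols : A *ᵥ d = ∑ j, d j • Aᵀ j := by
      ext i
      simp [mulVec, dotProduct, Finset.sum_apply, mul_comm]
    rw [hcols, ← Fintype.sum_subtype_add_sum_subtype s (fun j => d j • Aᵀ j), add_eq_left]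
    exact Finset.sum_eq_zero fun j _ => by rw [hd j.1 j.2, zero_smul]
  rw [Fintype.linearIndependent_iff]
  constructor
  · intro h d hAd hd
    ext j
    by_cases hj : s j
    · exact h (fun j => d j.1) (by rw [← key d hd, hAd]) ⟨j, hj⟩
    · exact hd j hj
  · intro h g hg j
    let d : Fin n → ℝ := fun j => if hj : s j then g ⟨j, hj⟩ else 0
    have hd : ∀ j, ¬ s j → d j = 0 := fun j hj => dif_neg hj
    have hdg : ∀ j : {j : Fin n // s j}, d j.1 = g j := fun j => dif_pos j.2
    have hd0 : d = 0 := h d (by rw [key d hd]; simpa only [hdg] using hg) hd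
    rw [← hdg, hd0, Pi.zero_apply]

/-- A nonnegative vector can be moved a little in both directions along any vector supported on
its positive coordinates. -/
lemma exists_pos_abs_mul_le {ι : Type*} [Finite ι] {y d : ι → ℝ} (hy : ∀ j, 0 ≤ y j)
    (hd : ∀ j, ¬ 0 < y j → d j = 0) : ∃ ε : ℝ, 0 < ε ∧ ∀ j, |ε * d j| ≤ y j := by
  have h : ∀ᶠ ε : ℝ in nhdsWithin 0 (Set.Ioi 0), ∀ j, |ε * d j| ≤ y j := by
    rw [Filter.eventually_all]
    intro j
    by_cases hj : 0 < y j
    · have hc : Filter.Tendsto (fun ε : ℝ => |ε * d j|) (nhds 0) (nhds 0) :=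
        Continuous.tendsto' (by fun_prop) _ _ (by simp)
      exact ((hc.eventually_lt_const hj).filter_mono nhdsWithin_le_nhds).mono fun _ => le_of_lt
    · simp [hd j hj, hy j]
  obtain ⟨ε, hε, hpos⟩ := (h.and self_mem_nhdsWithin).exists
  exact ⟨ε, hpos, hε⟩

theorem stmt_9 {m n : ℕ} (A : Matrix (Fin m) (Fin n) ℝ) (b : Fin m → ℝ)
    (p : Fin n → ℝ)
    (X Xstar Y Ystar : Set (Fin n → ℝ))
    (hX : X = {x | A *ᵥ x = b ∧ ∀ j, 0 ≤ x j})
    (hXne : X.Nonempty) (hXbd : Bornology.IsBounded X)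
    (hXstar : Xstar =
      {x ∈ X | LinearIndependent ℝ (fun j : {j : Fin n // 0 < x j} => Aᵀ j.1)})
    (hY : Y = {y ∈ X | ∀ x ∈ X, p ⬝ᵥ x ≤ p ⬝ᵥ y})
    (hYstar : Ystar = Y ∩ Xstar) :
    Ystar = {y ∈ Y | ¬ ∃ y1 ∈ Y, ∃ y2 ∈ Y, y1 ≠ y2 ∧ ∃ α : ℝ, 0 < α ∧ α < 1 ∧
        y = α • y1 + (1 - α) • y2} := by
  have hYX : ∀ y ∈ Y, A *ᵥ y = b ∧ ∀ j, 0 ≤ y j := by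
    intro y hy
    rw [hY, hX] at hy
    exact hy.1
  subst hYstar hXstar
  ext y
  simp only [Set.mem_inter_iff, Set.mem_ofPred_eq, linearIndependent_cols_subtype_iff]
  refine and_congr_right fun hyY => ?_
  constructor
  · rintro ⟨-, hli⟩ ⟨y1, h1, y2, h2, hne, α, h0, h1', rfl⟩
    obtain ⟨hA1, hp1⟩ := hYX y1 h1
    obtain ⟨hA2, hp2⟩ := hYX y2 h2
    refine hne (sub_eq_zero.mp (hli (y1 - y2) (by rw [mulVec_sub, hA1, hA2, sub_self]) ?_))
    intro j hj
    simp only [Pi.add_apply, Pi.smul_apply, smul_eq_mul, not_lt] at hj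
    have e1 := mul_nonneg h0.le (hp1 j)
    have e2 := mul_nonneg (sub_pos.2 h1').le (hp2 j)
    have z1 : y1 j = 0 := (mul_eq_zero.1 (by linarith : α * y1 j = 0)).resolve_left h0.ne'
    have z2 : y2 j = 0 :=
      (mul_eq_zero.1 (by linarith : (1 - α) * y2 j = 0)).resolve_left (sub_pos.2 h1').ne'
    simp [z1, z2]
  · intro hext
    obtain ⟨hAy, hpy⟩ := hYX y hyY
    have hyX : y ∈ X := by rw [hX]; exact ⟨hAy, hpy⟩
    have hopt : ∀ x ∈ X, p ⬝ᵥ x ≤ p ⬝ᵥ y := by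
      rw [hY] at hyY
      exact hyY.2
    refine ⟨hyX, fun d hAd hd => ?_⟩
    by_contra hd0
    obtain ⟨ε, hε, hle⟩ := exists_pos_abs_mul_le hpy hd
    have hplus : y + ε • d ∈ X := by
      rw [hX]
      refine ⟨by rw [mulVec_add, mulVec_smul, hAd, smul_zero, add_zero, hAy], fun j => ?_⟩
      have := (abs_le.1 (hle j)).1
      simp only [Pi.add_apply, Pi.smul_apply, smul_eq_mul]
      linarith
    have hminus : y - ε • d ∈ X := by
      rw [hX]
      refine ⟨by rw [mulVec_sub, mulVec_smul, hAd, smul_zero, sub_zero, hAy], fun j => ?_⟩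
      have := (abs_le.1 (hle j)).2
      simp only [Pi.sub_apply, Pi.smul_apply, smul_eq_mul]
      linarith
    have hp : p ⬝ᵥ (ε • d) = 0 := by
      have e1 := hopt _ hplus
      have e2 := hopt _ hminus
      rw [dotProduct_add] at e1
      rw [dotProduct_sub] at e2
      linarith
    refine hext ⟨y + ε • d, ?_, y - ε • d, ?_, ?_, 1 / 2, by norm_num, by norm_num, ?_⟩
    · rw [hY]
      exact ⟨hplus, fun x hx => by rw [dotProduct_add, hp, add_zero]; exact hopt x hx⟩
    · rw [hY]
      exact ⟨hminus, fun x hx => by rw [dotProduct_sub, hp, sub_zero]; exact hopt x hx⟩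
    · intro heq
      refine hd0 (funext fun j => ?_)
      have hj := congrFun heq j
      simp only [Pi.add_apply, Pi.sub_apply, Pi.smul_apply, smul_eq_mul] at hj
      exact (mul_eq_zero.1 (by linarith : ε * d j = 0)).resolve_left hε.ne'
    · module
end

section
/- Suppose X = {x ∈ ℝ^n : Ax = b, x ≥ 0} is nonempty and bounded. Then X equals the set of all convex combinations of its (finitely many) basic solutions, i.e., X = { Σ_{x* ∈ X*} α_{x*} x* : α_{x*} ≥ 0 for all x* ∈ X* and Σ_{x* ∈ X*} α_{x*} = 1 }, and X* is exactly the set of extreme points of X. -/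
open Matrix

/-- The columns of `A` indexed by `p` are linearly independent iff the only vector in the kernel
of `A` supported on `p` is zero. -/
theorem linearIndependent_columns_iff {m n : ℕ} (A : Matrix (Fin m) (Fin n) ℝ)
    (p : Fin n → Prop) :
    LinearIndependent ℝ (fun j : {j : Fin n // p j} => Aᵀ j.1) ↔
      ∀ d : Fin n → ℝ, A *ᵥ d = 0 → (∀ j, ¬ p j → d j = 0) → d = 0 := by
  classical
  have key : ∀ d : Fin n → ℝ, (∀ j, ¬ p j → d j = 0) →
      A *ᵥ d = ∑ j : {j : Fin n // p j}, d j.1 • Aᵀ j.1 := by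
    intro d hd
    have h1 : A *ᵥ d = ∑ j, d j • Aᵀ j := by
      ext i
      simp [Matrix.mulVec, dotProduct, Finset.sum_apply, mul_comm]
    rw [h1, ← Finset.sum_subtype (Finset.univ.filter p) (by simp) (fun j => d j • Aᵀ j)]
    refine (Finset.sum_subset (Finset.subset_univ _) ?_).symm
    intro j _ hj
    rw [hd j (by simpa using hj), zero_smul]
  rw [Fintype.linearIndependent_iff]
  constructor
  · intro h d hAd hd
    rw [key d hd] at hAd
    have h2 := h (fun j => d j.1) hAd
    funext j
    by_cases hj : p j
    · exact h2 ⟨j, hj⟩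
    · exact hd j hj
  · intro h g hg j
    have hd : ∀ j, ¬ p j → (fun j => if hj : p j then g ⟨j, hj⟩ else 0) j = 0 := by
      intro j hj
      simp [hj]
    have h2 := h (fun j => if hj : p j then g ⟨j, hj⟩ else 0)
      (by rw [key _ hd, ← hg]; exact Finset.sum_congr rfl fun j _ => by simp [j.2]) hd
    simpa [j.2] using congrFun h2 j.1

/-- A nonnegative vector can be moved a little both ways along a direction supported on its
positive coordinates while staying nonnegative. -/
theorem exists_pos_nonneg_add_sub {ι : Type*} [Finite ι] {x d : ι → ℝ} (hx : ∀ j, 0 ≤ x j)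
    (hd : ∀ j, ¬ 0 < x j → d j = 0) :
    ∃ t : ℝ, 0 < t ∧ ∀ j, 0 ≤ x j + t * d j ∧ 0 ≤ x j - t * d j := by
  have hev : ∀ᶠ t in nhdsWithin (0 : ℝ) (Set.Ioi 0),
      ∀ j, 0 ≤ x j + t * d j ∧ 0 ≤ x j - t * d j := by
    refine Filter.eventually_all.2 fun j => ?_
    by_cases hj : 0 < x j
    · refine Filter.Eventually.filter_mono nhdsWithin_le_nhds ?_
      have h1 : ∀ᶠ t in nhds (0 : ℝ), 0 < x j + t * d j :=
        (by fun_prop : Continuous fun t : ℝ => x j + t * d j).continuousAt.eventually_const_lt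
          (by simpa using hj)
      have h2 : ∀ᶠ t in nhds (0 : ℝ), 0 < x j - t * d j :=
        (by fun_prop : Continuous fun t : ℝ => x j - t * d j).continuousAt.eventually_const_lt
          (by simpa using hj)
      filter_upwards [h1, h2] with t ht1 ht2 using ⟨ht1.le, ht2.le⟩
    · simp [hd j hj, hx j]
  obtain ⟨t, ht, ht0⟩ := (hev.and self_mem_nhdsWithin).exists
  exact ⟨t, ht0, ht⟩

theorem stmt_10 {m n : ℕ} (A : Matrix (Fin m) (Fin n) ℝ) (b : Fin m → ℝ)
    (X Xstar : Set (Fin n → ℝ))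
    (hX : X = {x | A *ᵥ x = b ∧ ∀ j, 0 ≤ x j})
    (hXne : X.Nonempty) (hXbd : Bornology.IsBounded X)
    (hXstar : Xstar =
      {x ∈ X | LinearIndependent ℝ (fun j : {j : Fin n // 0 < x j} => Aᵀ j.1)}) :
    (X = {x | ∃ (s : Finset (Fin n → ℝ)) (w : (Fin n → ℝ) → ℝ),
          ↑s ⊆ Xstar ∧ (∀ z ∈ s, 0 ≤ w z) ∧ ∑ z ∈ s, w z = 1 ∧
          ∑ z ∈ s, w z • z = x})
      ∧
    (Xstar = {x ∈ X | ¬ ∃ x1 ∈ X, ∃ x2 ∈ X, x1 ≠ x2 ∧ ∃ α : ℝ, 0 < α ∧ α < 1 ∧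
        x = α • x1 + (1 - α) • x2}) := by
  have memX : ∀ x, x ∈ X ↔ A *ᵥ x = b ∧ ∀ j, 0 ≤ x j := fun x => by rw [hX]; rfl
  have memS : ∀ x, x ∈ Xstar ↔ x ∈ X ∧
      ∀ d : Fin n → ℝ, A *ᵥ d = 0 → (∀ j, ¬ 0 < x j → d j = 0) → d = 0 := fun x => by
    rw [hXstar, ← linearIndependent_columns_iff]; rfl
  have hext : Xstar = {x ∈ X | ¬ ∃ x1 ∈ X, ∃ x2 ∈ X, x1 ≠ x2 ∧ ∃ α : ℝ, 0 < α ∧ α < 1 ∧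
      x = α • x1 + (1 - α) • x2} := by
    ext x
    rw [memS, Set.mem_sep_iff]
    refine and_congr_right fun hx => ⟨?_, ?_⟩
    · rintro h ⟨x1, h1, x2, h2, hne, α, h0, h1', hxe⟩
      rw [memX] at h1 h2
      refine hne (sub_eq_zero.1 (h (x1 - x2) ?_ fun j hj => ?_))
      · rw [Matrix.mulVec_sub, h1.1, h2.1, sub_self]
      · have hxj : x j = α * x1 j + (1 - α) * x2 j := by rw [hxe]; simp
        have p1 := mul_nonneg h0.le (h1.2 j)
        have p2 := mul_nonneg (sub_nonneg.2 h1'.le) (h2.2 j)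
        have e1 : α * x1 j = 0 := by linarith
        have e2 : (1 - α) * x2 j = 0 := by linarith
        have e1' := (mul_eq_zero.1 e1).resolve_left h0.ne'
        have e2' := (mul_eq_zero.1 e2).resolve_left (sub_pos.2 h1').ne'
        simp [e1', e2']
    · intro h d hAd hd
      by_contra hd0
      obtain ⟨hxA, hx0⟩ := (memX x).1 hx
      obtain ⟨t, ht, hnn⟩ := exists_pos_nonneg_add_sub hx0 hd
      refine h ⟨x + t • d, (memX _).2 ⟨?_, fun j => (hnn j).1⟩,
        x - t • d, (memX _).2 ⟨?_, fun j => (hnn j).2⟩, ?_, 1 / 2, by norm_num, by norm_num, ?_⟩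
      · simp [Matrix.mulVec_add, Matrix.mulVec_smul, hAd, hxA]
      · simp [Matrix.mulVec_sub, Matrix.mulVec_smul, hAd, hxA]
      · intro he
        apply hd0
        funext j
        have hj := congrFun he j
        simp only [Pi.add_apply, Pi.sub_apply, Pi.smul_apply, smul_eq_mul] at hj
        have : t * d j = 0 := by linarith
        exact (mul_eq_zero.1 this).resolve_left ht.ne'
      · module
  refine ⟨?_, hext⟩
  have hextr : X.extremePoints ℝ = Xstar := by
    rw [hext]
    ext x
    rw [mem_extremePoints_iff_left, Set.mem_sep_iff]
    refine and_congr_right fun hx => ⟨?_, ?_⟩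
    · rintro h ⟨x1, h1, x2, h2, hne, α, h0, h1', rfl⟩
      have e1 := h x1 h1 x2 h2 ⟨α, 1 - α, h0, sub_pos.2 h1', by ring, rfl⟩
      have e2 := h x2 h2 x1 h1 ⟨1 - α, α, sub_pos.2 h1', h0, by ring, add_comm _ _⟩
      exact hne (e1.trans e2.symm)
    · rintro h x1 h1 x2 h2 ⟨α, β, hα, hβ, hαβ, rfl⟩
      obtain rfl : β = 1 - α := by linarith
      by_contra hne
      refine h ⟨x1, h1, x2, h2, ?_, α, hα, by linarith, rfl⟩
      rintro rfl
      exact hne (by module)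
  have hfin : Xstar.Finite := by
    refine Set.Finite.of_finite_image (f := fun x => {j | 0 < x j}) (Set.toFinite _) ?_
    intro x hx y hy hxy
    rw [memS] at hx hy
    have hsupp : ∀ j, 0 < x j ↔ 0 < y j := fun j => Set.ext_iff.1 hxy j
    obtain ⟨hxX, hxd⟩ := hx
    have hyX := hy.1
    rw [memX] at hxX hyX
    refine sub_eq_zero.1 (hxd (x - y) ?_ fun j hj => ?_)
    · rw [Matrix.mulVec_sub, hxX.1, hyX.1, sub_self]
    · have hj' := mt (hsupp j).2 hj
      have := hxX.2 j
      have := hyX.2 j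
      rw [Pi.sub_apply]
      linarith
  have hconv : Convex ℝ X := by
    intro x hx y hy α β hα hβ hαβ
    rw [memX] at *
    refine ⟨?_, fun j => ?_⟩
    · rw [Matrix.mulVec_add, Matrix.mulVec_smul, Matrix.mulVec_smul, hx.1, hy.1, ← add_smul, hαβ,
        one_smul]
    · exact add_nonneg (mul_nonneg hα (hx.2 j)) (mul_nonneg hβ (hy.2 j))
  have hclosed : IsClosed X := by
    rw [hX]
    exact (isClosed_eq (by fun_prop) continuous_const).inter
      (isClosed_le continuous_const continuous_id)
  have hKM := closure_convexHull_extremePoints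
    (Metric.isCompact_of_isClosed_isBounded hclosed hXbd) hconv
  rw [hextr, (hfin.isCompact_convexHull ℝ).isClosed.closure_eq] at hKM
  ext x
  constructor
  · intro hx
    rw [← hKM, ← hfin.coe_toFinset, Finset.mem_convexHull'] at hx
    obtain ⟨w, hw0, hw1, hwx⟩ := hx
    exact ⟨hfin.toFinset, w, by simp, hw0, hw1, hwx⟩
  · rintro ⟨s, w, hs, hw0, hw1, rfl⟩
    exact hconv.sum_mem hw0 hw1 fun z hz => ((memS z).1 (hs hz)).1
end

section
/- If an n×n doubly stochastic matrix P is not a permutation matrix, then there exist two distinct n×n doubly stochastic matrices Q⁽¹⁾ and Q⁽²⁾ such that P = ½ Q⁽¹⁾ + ½ Q⁽²⁾. In particular, P is not an extreme point of the set of n×n doubly stochastic matrices. -/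
open Matrix

/-- An `n × n` real matrix is doubly stochastic if all its entries are
nonnegative, every row sums to 1 and every column sums to 1. -/
def IsDoublyStochastic {n : ℕ} (P : Matrix (Fin n) (Fin n) ℝ) : Prop :=
  (∀ i j, 0 ≤ P i j) ∧ (∀ i, ∑ j, P i j = 1) ∧ (∀ j, ∑ i, P i j = 1)

/-- A permutation matrix is a doubly stochastic matrix all of whose entries
are 0 or 1. -/
def IsPermutationMatrix {n : ℕ} (P : Matrix (Fin n) (Fin n) ℝ) : Prop :=
  IsDoublyStochastic P ∧ ∀ i j, P i j = 0 ∨ P i j = 1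

theorem isDoublyStochastic_iff_mem_doublyStochastic {n : ℕ} {P : Matrix (Fin n) (Fin n) ℝ} :
    IsDoublyStochastic P ↔ P ∈ doublyStochastic ℝ (Fin n) :=
  mem_doublyStochastic_iff_sum.symm

theorem isPermutationMatrix_of_mem_extremePoints {n : ℕ} {P : Matrix (Fin n) (Fin n) ℝ}
    (hP : P ∈ Set.extremePoints ℝ (doublyStochastic ℝ (Fin n) : Set (Matrix (Fin n) (Fin n) ℝ))) :
    IsPermutationMatrix P := by
  refine ⟨isDoublyStochastic_iff_mem_doublyStochastic.2 hP.1, fun i j => ?_⟩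
  rw [extremePoints_doublyStochastic] at hP
  obtain ⟨σ, rfl⟩ := hP
  rw [Equiv.Perm.permMatrix, PEquiv.toMatrix_apply]
  exact (ite_eq_or_eq _ _ _).symm

/-- A non-extreme point of a convex set is the midpoint of two distinct points of the set. -/
theorem Convex.exists_ne_eq_midpoint_of_notMem_extremePoints {E : Type*} [AddCommGroup E]
    [Module ℝ E] {s : Set E} (hs : Convex ℝ s) {x : E} (hx : x ∈ s)
    (hext : x ∉ s.extremePoints ℝ) :
    ∃ y ∈ s, ∃ z ∈ s, y ≠ z ∧ x = (1 / 2 : ℝ) • y + (1 / 2 : ℝ) • z := by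
  have hne : ∃ u ∈ s, ∃ v ∈ s, x ∈ openSegment ℝ u v ∧ u ≠ x := by
    by_contra! h
    exact hext ⟨hx, fun u hu v hv huv => h u hu v hv huv⟩
  obtain ⟨u, hu, v, hv, ⟨a, b, ha, hb, hab, rfl⟩, hux⟩ := hne
  have huv : u ≠ v := by
    rintro rfl
    exact hux (by rw [← add_smul, hab, one_smul])
  have hc : 0 < min a b := lt_min ha hb
  have hca := min_le_left a b
  have hcb := min_le_right a b
  generalize min a b = c at hc hca hcb
  refine ⟨(a + c) • u + (b - c) • v, hs hu hv (by linarith) (by linarith) (by linarith),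
    (a - c) • u + (b + c) • v, hs hu hv (by linarith) (by linarith) (by linarith), ?_, by module⟩
  intro h
  have hzero : (2 * c) • (u - v) = 0 := by
    rw [← sub_eq_zero] at h
    rw [← h]
    module
  exact (smul_ne_zero (by positivity) (sub_ne_zero.2 huv)) hzero

theorem stmt_11 {n : ℕ} (P : Matrix (Fin n) (Fin n) ℝ)
    (hP : IsDoublyStochastic P) (hnotperm : ¬ IsPermutationMatrix P) :
    (∃ Q1 Q2 : Matrix (Fin n) (Fin n) ℝ, IsDoublyStochastic Q1 ∧
      IsDoublyStochastic Q2 ∧ Q1 ≠ Q2 ∧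
      P = (1 / 2 : ℝ) • Q1 + (1 / 2 : ℝ) • Q2)
    ∧
    -- in particular, P is not an extreme point of the set of doubly
    -- stochastic matrices
    (∃ Q1 Q2 : Matrix (Fin n) (Fin n) ℝ, IsDoublyStochastic Q1 ∧
      IsDoublyStochastic Q2 ∧ Q1 ≠ Q2 ∧ ∃ α : ℝ, 0 < α ∧ α < 1 ∧
      P = α • Q1 + (1 - α) • Q2) := by
  obtain ⟨Q1, hQ1, Q2, hQ2, hne, heq⟩ :=
    convex_doublyStochastic.exists_ne_eq_midpoint_of_notMem_extremePoints
      (isDoublyStochastic_iff_mem_doublyStochastic.1 hP)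
      (mt isPermutationMatrix_of_mem_extremePoints hnotperm)
  have h1 := isDoublyStochastic_iff_mem_doublyStochastic.2 hQ1
  have h2 := isDoublyStochastic_iff_mem_doublyStochastic.2 hQ2
  refine ⟨⟨Q1, Q2, h1, h2, hne, heq⟩, Q1, Q2, h1, h2, hne, 1 / 2, by norm_num, by norm_num, ?_⟩
  rw [show (1 - 1 / 2 : ℝ) = 1 / 2 by norm_num]
  exact heq
end

section
/- The set of extreme points of the (convex) set of all n×n doubly stochastic matrices is exactly the set of all n×n permutation matrices. -/
open Matrix

theorem IsDoublyStochastic.le_one {n : ℕ} {P : Matrix (Fin n) (Fin n) ℝ}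
    (hP : IsDoublyStochastic P) (i j : Fin n) : P i j ≤ 1 :=
  le_one_of_mem_doublyStochastic (isDoublyStochastic_iff_mem_doublyStochastic.1 hP)

theorem isPermutationMatrix_permMatrix {n : ℕ} (σ : Equiv.Perm (Fin n)) :
    IsPermutationMatrix (σ.permMatrix ℝ) := by
  refine ⟨isDoublyStochastic_iff_mem_doublyStochastic.2 permMatrix_mem_doublyStochastic,
    fun i j => ?_⟩
  rw [Equiv.Perm.permMatrix, PEquiv.toMatrix_apply]
  split_ifs <;> simp

theorem stmt_14 (n : ℕ) :
    {P : Matrix (Fin n) (Fin n) ℝ | IsDoublyStochastic P ∧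
        ¬ ∃ Q1 : Matrix (Fin n) (Fin n) ℝ, IsDoublyStochastic Q1 ∧
          ∃ Q2 : Matrix (Fin n) (Fin n) ℝ, IsDoublyStochastic Q2 ∧
            Q1 ≠ Q2 ∧ ∃ α : ℝ, 0 < α ∧ α < 1 ∧ P = α • Q1 + (1 - α) • Q2}
      = {P : Matrix (Fin n) (Fin n) ℝ | IsPermutationMatrix P} := by
  ext P
  constructor
  · rintro ⟨hP, hext⟩
    have hmem : P ∈ Set.extremePoints ℝ (doublyStochastic ℝ (Fin n) : Set _) := by
      refine ⟨isDoublyStochastic_iff_mem_doublyStochastic.1 hP, ?_⟩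
      rintro A hA B hB ⟨a, b, ha, hb, hab, rfl⟩
      obtain rfl : b = 1 - a := by linarith
      by_cases h : A = B
      · rw [h, ← add_smul, add_sub_cancel, one_smul]
      · exact absurd ⟨A, isDoublyStochastic_iff_mem_doublyStochastic.2 hA,
          B, isDoublyStochastic_iff_mem_doublyStochastic.2 hB, h, a, ha, by linarith, rfl⟩ hext
    rw [extremePoints_doublyStochastic] at hmem
    obtain ⟨σ, rfl⟩ := hmem
    exact isPermutationMatrix_permMatrix σ
  · rintro ⟨hP, h01⟩
    refine ⟨hP, ?_⟩
    rintro ⟨A, hA, B, hB, hne, a, ha, ha1, rfl⟩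
    refine hne (Matrix.ext fun i j => ?_)
    have hA0 := hA.1 i j
    have hB0 := hB.1 i j
    have hA1 := hA.le_one i j
    have hB1 := hB.le_one i j
    have h := h01 i j
    simp only [Matrix.add_apply, Matrix.smul_apply, smul_eq_mul] at h
    rcases h with h | h
    · have hA' : A i j = 0 := by nlinarith
      have hB' : B i j = 0 := by nlinarith
      rw [hA', hB']
    · have hA' : A i j = 1 := by nlinarith
      have hB' : B i j = 1 := by nlinarith
      rw [hA', hB']
end
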